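/- arXiv:1107.0802 — 2 statements merged into one kernel-verified Lean document; each statement's English description precedes it below -/
import Mathlib

section
/- Let Λ > 0 and let φ ∈ C²([0,∞)×[0,∞)) be a solution of the spherically symmetric wave equation on de Sitter spacetime in Bondi coordinates: −2r ∂²φ/∂r∂u − 2 ∂φ/∂u + r(1 − (Λ/3) r²) ∂²φ/∂r² + (2 − (4Λ/3) r²) ∂φ/∂r = 0 on [0,∞)×[0,∞). Then |φ(u,r)| ≤ sup_{r ≥ 0} |∂/∂r (r φ(0,r))| for all (u,r) ∈ [0,∞)×[0,∞). -/
open Real Set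

/-- Partial derivative in the `u` direction (within `[0,∞)`). -/
noncomputable def pderivU (φ : ℝ → ℝ → ℝ) (u r : ℝ) : ℝ :=
  derivWithin (fun u' => φ u' r) (Set.Ici 0) u

/-- Partial derivative in the `r` direction (within `[0,∞)`). -/
noncomputable def pderivR (φ : ℝ → ℝ → ℝ) (u r : ℝ) : ℝ :=
  derivWithin (fun r' => φ u r') (Set.Ici 0) r

/-- `φ` solves the spherically symmetric wave equation `□_g φ = 0` on de Sitter
spacetime in Bondi coordinates:
`-2r ∂²φ/∂r∂u - 2 ∂φ/∂u + r(1 - (Λ/3)r²) ∂²φ/∂r² + (2 - (4Λ/3)r²) ∂φ/∂r = 0`. -/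
def IsWaveSol (Λ : ℝ) (φ : ℝ → ℝ → ℝ) : Prop :=
  ∀ u r : ℝ, 0 ≤ u → 0 ≤ r →
    -2 * r * pderivR (pderivU φ) u r - 2 * pderivU φ u r
      + r * (1 - Λ/3 * r^2) * pderivR (pderivR φ) u r
      + (2 - 4 * Λ / 3 * r^2) * pderivR φ u r = 0

/-- If `g` is maximal over `s` at `a`, its one-sided derivative at `a` towards any `b` with
`[a, b] ⊆ s` is nonpositive. -/
lemma HasDerivWithinAt.mul_sub_nonpos_of_isMaxOn {g : ℝ → ℝ} {g' a b : ℝ} {s t : Set ℝ}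
    (hg : HasDerivWithinAt g g' t a) (hmax : IsMaxOn g s a)
    (hs : segment ℝ a b ⊆ s) (ht : s ⊆ t) : g' * (b - a) ≤ 0 := by
  have h := IsLocalMaxOn.hasFDerivWithinAt_nonpos hmax.localize
    (hg.mono ht).hasFDerivWithinAt (sub_mem_posTangentConeAt_of_segment_subset hs)
  simpa [mul_comm] using h

/-- A function is bounded by a bound for the derivative of `r * w r` on `[0, R]`. -/
lemma abs_le_of_hasDerivWithinAt_id_mul {w w' : ℝ → ℝ} {R C : ℝ} (hR : 0 ≤ R)
    (hw : ∀ r ∈ Icc 0 R, HasDerivWithinAt w (w' r) (Icc 0 R) r)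
    (hC : ∀ r ∈ Icc 0 R, |w r + r * w' r| ≤ C) : |w R| ≤ C := by
  rcases hR.eq_or_lt with rfl | hpos
  · simpa using hC 0 (by simp)
  · have key := (convex_Icc 0 R).norm_image_sub_le_of_norm_hasDerivWithin_le
      (f := fun r => r * w r) (f' := fun r => w r + r * w' r) (C := C)
      (fun r hr => by simpa using (hasDerivAt_id' r).hasDerivWithinAt.fun_mul (hw r hr))
      hC (left_mem_Icc.2 hR) (right_mem_Icc.2 hR)
    simp only [Real.norm_eq_abs, zero_mul, sub_zero, abs_mul, abs_of_pos hpos] at key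
    nlinarith

/-- Maximum principle for `h = ∂_r (r φ)` satisfying the transport equation
`∂_u h - (1 - k r²)/2 ∂_r h = -k r (h - φ)`. -/
lemma abs_le_of_transport {k M : ℝ} (hk : 0 < k) {φ G h hu hr : ℝ → ℝ → ℝ}
    (hcont : ContinuousOn (fun q : ℝ × ℝ => h q.1 q.2) (Ici 0 ×ˢ Ici 0))
    (hh : ∀ u r, h u r = φ u r + r * G u r)
    (hG : ∀ u r, 0 ≤ u → 0 ≤ r → HasDerivWithinAt (fun r' => φ u r') (G u r) (Ici 0) r)
    (hhu : ∀ u r, 0 ≤ u → 0 ≤ r → HasDerivWithinAt (fun u' => h u' r) (hu u r) (Ici 0) u)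
    (hhr : ∀ u r, 0 ≤ u → 0 ≤ r → HasDerivWithinAt (fun r' => h u r') (hr u r) (Ici 0) r)
    (heq : ∀ u r, 0 ≤ u → 0 ≤ r →
      hu u r - (1 - k * r ^ 2) / 2 * hr u r = -(k * r * (h u r - φ u r)))
    (h0 : ∀ r, 0 ≤ r → |h 0 r| ≤ M) {u r : ℝ} (hu0 : 0 ≤ u) (hr0 : 0 ≤ r) :
    |h u r| ≤ M := by
  have hM : 0 ≤ M := (abs_nonneg _).trans (h0 0 le_rfl)
  refine abs_le_of_sq_le_sq ?_ hM
  obtain ⟨R, hrR, hR1, hRk⟩ : ∃ R, r ≤ R ∧ 1 ≤ R ∧ 1 ≤ k * R ^ 2 := by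
    refine ⟨max r (max 1 (1 / k)), le_max_left _ _,
      (le_max_left _ _).trans (le_max_right _ _), ?_⟩
    have h1 : 1 ≤ max r (max 1 (1 / k)) := (le_max_left _ _).trans (le_max_right _ _)
    have h2 : 1 / k ≤ max r (max 1 (1 / k)) := (le_max_right _ _).trans (le_max_right _ _)
    rw [div_le_iff₀ hk] at h2
    nlinarith
  have hR0 : 0 ≤ R := by linarith
  refine le_of_forall_pos_le_add fun δ hδ => ?_
  obtain ⟨ε, hε, hεδ⟩ : ∃ ε > 0, ε * u ≤ δ := by
    refine ⟨δ / (u + 1), by positivity, ?_⟩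
    rw [div_mul_eq_mul_div, div_le_iff₀ (by positivity)]
    nlinarith
  have hsub : Icc 0 u ×ˢ Icc 0 R ⊆ (Ici 0 ×ˢ Ici 0 : Set (ℝ × ℝ)) :=
    prod_mono Icc_subset_Ici_self Icc_subset_Ici_self
  obtain ⟨⟨a, b⟩, ⟨⟨ha0, hau⟩, hb0, hbR⟩, hmax⟩ :=
    (isCompact_Icc.prod isCompact_Icc).exists_isMaxOn (s := Icc 0 u ×ˢ Icc 0 R)
      (f := fun q : ℝ × ℝ => h q.1 q.2 ^ 2 - ε * q.1)
      ⟨(0, 0), ⟨le_rfl, hu0⟩, le_rfl, hR0⟩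
      (((hcont.mono hsub).pow 2).sub (by fun_prop))
  simp only at ha0 hau hb0 hbR
  have hle : ∀ a' b', 0 ≤ a' → a' ≤ u → 0 ≤ b' → b' ≤ R →
      h a' b' ^ 2 - ε * a' ≤ h a b ^ 2 - ε * a :=
    fun a' b' h1 h2 h3 h4 => hmax (a := (a', b')) ⟨⟨h1, h2⟩, h3, h4⟩
  have hpt := hle u r hu0 le_rfl hr0 hrR
  rcases ha0.eq_or_lt with rfl | hapos
  · have := sq_le_sq' (neg_le_of_abs_le (h0 b hb0)) (le_of_abs_le (h0 b hb0))
    linarith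
  exfalso
  have hφ : |φ a b| ≤ |h a b| := by
    refine abs_le_of_hasDerivWithinAt_id_mul (w := φ a) (w' := G a) hb0
      (fun s hs => (hG a s ha0 hs.1).mono Icc_subset_Ici_self) fun s hs => ?_
    rw [← hh, ← sq_le_sq]
    linarith [hle a s ha0 hau hs.1 (hs.2.trans hbR)]
  have hU : ε ≤ 2 * h a b * hu a b := by
    have hd : HasDerivWithinAt (fun u' => h u' b ^ 2 - ε * u') (2 * h a b * hu a b - ε)
        (Ici 0) a := by
      simpa using ((hhu a b ha0 hb0).fun_pow 2).fun_sub
        ((hasDerivAt_id' a).hasDerivWithinAt.const_mul ε)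
    have := hd.mul_sub_nonpos_of_isMaxOn (s := Icc 0 a) (b := 0)
      (fun a' h' => hle a' b h'.1 (h'.2.trans hau) hb0 hbR)
      (by rw [segment_symm, segment_eq_Icc ha0]) Icc_subset_Ici_self
    nlinarith
  have hd : HasDerivWithinAt (fun r' => h a r' ^ 2 - ε * a) (2 * h a b * hr a b)
      (Ici 0) b := by
    simpa using ((hhr a b ha0 hb0).fun_pow 2).sub_const (ε * a)
  have hmaxr : IsMaxOn (fun r' => h a r' ^ 2 - ε * a) (Icc 0 R) b :=
    fun b' h' => hle a b' ha0 hau h'.1 h'.2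
  have hRad : (1 - k * b ^ 2) * (h a b * hr a b) ≤ 0 := by
    rcases le_or_gt (1 - k * b ^ 2) 0 with hc | hc
    · have hbpos : 0 < b := hb0.lt_of_ne (by rintro rfl; norm_num at hc)
      have := hd.mul_sub_nonpos_of_isMaxOn (b := 0) hmaxr
        (by rw [segment_symm, segment_eq_Icc hb0]; exact Icc_subset_Icc_right hbR)
        Icc_subset_Ici_self
      have : 0 ≤ h a b * hr a b := by
        by_contra! hneg
        nlinarith
      exact mul_nonpos_of_nonpos_of_nonneg hc this
    · have hbltR : b < R := hbR.lt_of_ne (by rintro rfl; linarith)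
      have := hd.mul_sub_nonpos_of_isMaxOn (b := R) hmaxr
        (by rw [segment_eq_Icc hbR]; exact Icc_subset_Icc_left hb0)
        Icc_subset_Ici_self
      have : h a b * hr a b ≤ 0 := by
        by_contra! hneg
        nlinarith
      exact mul_nonpos_of_nonneg_of_nonpos hc.le this
  have hprod : 0 ≤ h a b * (h a b - φ a b) := by
    have h1 : h a b * φ a b ≤ |h a b| * |φ a b| := by
      rw [← abs_mul]; exact le_abs_self _
    nlinarith [abs_mul_abs_self (h a b), abs_nonneg (h a b)]
  have hfin : h a b * hu a b - (1 - k * b ^ 2) * (h a b * hr a b) / 2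
      = -(k * b * (h a b * (h a b - φ a b))) := by
    linear_combination h a b * heq a b ha0 hb0
  have : 0 ≤ k * b * (h a b * (h a b - φ a b)) := by positivity
  linarith

lemma HasFDerivWithinAt.hasDerivWithinAt_fst {F : Type*} [NormedAddCommGroup F] [NormedSpace ℝ F]
    {f : ℝ × ℝ → F} {L : ℝ × ℝ →L[ℝ] F} {s t : Set ℝ} {u r : ℝ}
    (hf : HasFDerivWithinAt f L (s ×ˢ t) (u, r)) (hr : r ∈ t) :
    HasDerivWithinAt (fun u' => f (u', r)) (L (1, 0)) s u :=
  hf.comp_hasDerivWithinAt (f := fun u' => (u', r)) u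
    ((hasDerivWithinAt_id u s).prodMk (hasDerivWithinAt_const u s r)) fun _ hx => ⟨hx, hr⟩

lemma HasFDerivWithinAt.hasDerivWithinAt_snd {F : Type*} [NormedAddCommGroup F] [NormedSpace ℝ F]
    {f : ℝ × ℝ → F} {L : ℝ × ℝ →L[ℝ] F} {s t : Set ℝ} {u r : ℝ}
    (hf : HasFDerivWithinAt f L (s ×ˢ t) (u, r)) (hu : u ∈ s) :
    HasDerivWithinAt (fun r' => f (u, r')) (L (0, 1)) t r :=
  hf.comp_hasDerivWithinAt (f := fun r' => (u, r')) r
    ((hasDerivWithinAt_const r t u).prodMk (hasDerivWithinAt_id r t)) fun _ hx => ⟨hu, hx⟩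

/-- Boundedness of spherical linear waves in de Sitter: if
`φ ∈ C²([0,∞)²)` solves the spherically symmetric wave equation, then
`|φ(u,r)| ≤ sup_{r≥0} |∂_r (r φ(0,r))|`. -/
theorem wave_dS_boundedness
    (Λ : ℝ) (hΛ : 0 < Λ) (φ : ℝ → ℝ → ℝ)
    (hreg : ContDiffOn ℝ 2 (fun q : ℝ × ℝ => φ q.1 q.2) (Set.Ici 0 ×ˢ Set.Ici 0))
    (hwave : IsWaveSol Λ φ) :
    ∀ M : ℝ,
      (∀ r, 0 ≤ r → |derivWithin (fun r' => r' * φ 0 r') (Set.Ici 0) r| ≤ M) →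
      ∀ u r : ℝ, 0 ≤ u → 0 ≤ r → |φ u r| ≤ M := by
  intro M hM
  set S : Set (ℝ × ℝ) := Ici 0 ×ˢ Ici 0 with hS
  set f : ℝ × ℝ → ℝ := fun q => φ q.1 q.2 with hf
  set f' := fderivWithin ℝ f S with hf'
  set f'' := fderivWithin ℝ f' S with hf''
  have hI : UniqueDiffOn ℝ (Ici (0 : ℝ)) := uniqueDiffOn_Ici 0
  have hUD : UniqueDiffOn ℝ S := hI.prod hI
  have hreg' : ContDiffOn ℝ 1 f' S := hreg.fderivWithin hUD (by norm_num)
  have d1 : ∀ q ∈ S, HasFDerivWithinAt f (f' q) S q := fun q hq =>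
    (hreg.differentiableOn (by norm_num) q hq).hasFDerivWithinAt
  have d2 : ∀ q ∈ S, HasFDerivWithinAt f' (f'' q) S q := fun q hq =>
    (hreg'.differentiableOn (by norm_num) q hq).hasFDerivWithinAt
  have hsymm : ∀ q ∈ S, f'' q (1, 0) (0, 1) = f'' q (0, 1) (1, 0) := fun q hq => by
    refine (hreg q hq).isSymmSndFDerivWithinAt (by simp) hUD ?_ hq _ _
    rw [hS, interior_prod_eq, closure_prod_eq]
    simpa [hS] using hq
  have hφu : ∀ u r, 0 ≤ u → 0 ≤ r →
      HasDerivWithinAt (fun u' => φ u' r) (f' (u, r) (1, 0)) (Ici 0) u :=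
    fun u r hu hr => (d1 (u, r) ⟨hu, hr⟩).hasDerivWithinAt_fst hr
  have hφr : ∀ u r, 0 ≤ u → 0 ≤ r →
      HasDerivWithinAt (fun r' => φ u r') (f' (u, r) (0, 1)) (Ici 0) r :=
    fun u r hu hr => (d1 (u, r) ⟨hu, hr⟩).hasDerivWithinAt_snd hu
  have hf'u : ∀ u r v, 0 ≤ u → 0 ≤ r →
      HasDerivWithinAt (fun u' => f' (u', r) v) (f'' (u, r) (1, 0) v) (Ici 0) u :=
    fun u r v hu hr => by
      simpa using ((d2 (u, r) ⟨hu, hr⟩).hasDerivWithinAt_fst hr).clm_apply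
        (hasDerivWithinAt_const u _ v)
  have hf'r : ∀ u r v, 0 ≤ u → 0 ≤ r →
      HasDerivWithinAt (fun r' => f' (u, r') v) (f'' (u, r) (0, 1) v) (Ici 0) r :=
    fun u r v hu hr => by
      simpa using ((d2 (u, r) ⟨hu, hr⟩).hasDerivWithinAt_snd hu).clm_apply
        (hasDerivWithinAt_const r _ v)
  have pU : ∀ u r, 0 ≤ u → 0 ≤ r → pderivU φ u r = f' (u, r) (1, 0) :=
    fun u r hu hr => (hφu u r hu hr).derivWithin (hI u hu)
  have pR : ∀ u r, 0 ≤ u → 0 ≤ r → pderivR φ u r = f' (u, r) (0, 1) :=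
    fun u r hu hr => (hφr u r hu hr).derivWithin (hI r hr)
  have pRU : ∀ u r, 0 ≤ u → 0 ≤ r →
      pderivR (pderivU φ) u r = f'' (u, r) (0, 1) (1, 0) := fun u r hu hr =>
    ((hf'r u r (1, 0) hu hr).congr (fun r' hr' => pU u r' hu hr') (pU u r hu hr)).derivWithin
      (hI r hr)
  have pRR : ∀ u r, 0 ≤ u → 0 ≤ r →
      pderivR (pderivR φ) u r = f'' (u, r) (0, 1) (0, 1) := fun u r hu hr =>
    ((hf'r u r (0, 1) hu hr).congr (fun r' hr' => pR u r' hu hr') (pR u r hu hr)).derivWithin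
      (hI r hr)
  have hbound : ∀ u r, 0 ≤ u → 0 ≤ r → |φ u r + r * f' (u, r) (0, 1)| ≤ M := by
    intro u r hu hr
    refine abs_le_of_transport (k := Λ / 3) (by positivity) (φ := φ)
      (G := fun u r => f' (u, r) (0, 1))
      (h := fun u r => φ u r + r * f' (u, r) (0, 1))
      (hu := fun u r => f' (u, r) (1, 0) + r * f'' (u, r) (1, 0) (0, 1))
      (hr := fun u r => f' (u, r) (0, 1) + (f' (u, r) (0, 1) + r * f'' (u, r) (0, 1) (0, 1)))
      ?_ (fun _ _ => rfl) hφr ?_ ?_ ?_ ?_ hu hr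
    · exact hreg.continuousOn.add
        (continuousOn_snd.mul (hreg'.continuousOn.clm_apply continuousOn_const))
    · exact fun u r hu hr => (hφu u r hu hr).add ((hf'u u r (0, 1) hu hr).const_mul r)
    · intro u r hu hr
      simpa using (hφr u r hu hr).fun_add
        ((hasDerivAt_id' r).hasDerivWithinAt.fun_mul (hf'r u r (0, 1) hu hr))
    · intro u r hu hr
      have hw := hwave u r hu hr
      rw [pRU u r hu hr, pU u r hu hr, pRR u r hu hr, pR u r hu hr,
        ← hsymm (u, r) ⟨hu, hr⟩] at hw
      linear_combination (-1 / 2) * hw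
    · intro r hr
      have hd : HasDerivWithinAt (fun r' => r' * φ 0 r') (φ 0 r + r * f' (0, r) (0, 1))
          (Ici 0) r := by
        simpa using (hasDerivAt_id' r).hasDerivWithinAt.fun_mul (hφr 0 r le_rfl hr)
      simpa only [hd.derivWithin (hI r hr)] using hM r hr
  intro u r hu hr
  exact abs_le_of_hasDerivWithinAt_id_mul (w := φ u) (w' := fun r => f' (u, r) (0, 1)) hr
    (fun s hs => (hφr u s hu hs.1).mono Icc_subset_Ici_self)
    fun s hs => hbound u s hu hs.1
end

section
/- Let Λ > 0 and let φ ∈ C²([0,∞)×[0,∞)) be a solution of the spherically symmetric wave equation on de Sitter spacetime in Bondi coordinates: −2r ∂²φ/∂r∂u − 2 ∂φ/∂u + r(1 − (Λ/3) r²) ∂²φ/∂r² + (2 − (4Λ/3) r²) ∂φ/∂r = 0 on [0,∞)×[0,∞). Suppose in addition that sup_{r≥0} |∂/∂r (r φ(0,r))| < ∞ and sup_{r ≥ 0} (1+r)^p |∂²/∂r² (r φ(0,r))| < ∞ for some 0 ≤ p ≤ 4, and let 0 < H ≤ 2√(Λ/3). Then there exist a real constant φ̲ and a constant C > 0 such that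 |φ(u,r) − φ̲| ≤ C (1+r)^{n(p)} e^{−Hu} for all (u,r), where n(p) = 0 if 2 < p ≤ 4 and n(p) = 2 if 0 ≤ p ≤ 2. -/
open Real Set

/-- The exponent `n(p)`: `0` for `2 < p ≤ 4` and `2` for `0 ≤ p ≤ 2`. -/
noncomputable def nExp (p : ℝ) : ℝ := if 2 < p then 0 else 2

open Filter Topology

/-- If `∂ₜ B = g` and `y = ∂ᵣ g` is continuous, then `z = ∂ᵣ B` satisfies `∂ₜ z = y`; no
regularity of `z` is assumed. -/
theorem hasDerivWithinAt_of_mixed_partial {B g z y : ℝ → ℝ → ℝ} {T l m r : ℝ} (hr : r ∈ Ioo l m)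
    (hB : ∀ v ∈ Icc 0 T, ∀ s ∈ Icc l m, HasDerivAt (fun v' => B v' s) (g v s) v)
    (hz : ∀ v ∈ Icc 0 T, HasDerivAt (fun s' => B v s') (z v r) r)
    (hg : ∀ v ∈ Icc 0 T, ∀ s ∈ Icc l m, HasDerivAt (fun s' => g v s') (y v s) s)
    (hgc : ∀ s ∈ Icc l m, ContinuousOn (fun v => g v s) (Icc 0 T))
    (hy : ContinuousOn (fun q : ℝ × ℝ => y q.1 q.2) (Icc 0 T ×ˢ Icc l m))
    {t : ℝ} (ht : t ∈ Icc 0 T) :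
    HasDerivWithinAt (fun v => z v r) (y t r) (Icc 0 T) t := by
  have hT : 0 ≤ T := ht.1.trans ht.2
  have hrI : r ∈ Icc l m := Ioo_subset_Icc_self hr
  have hnhds : Icc l m ∈ 𝓝 r := Icc_mem_nhds hr.1 hr.2
  obtain ⟨K, hK⟩ := (isCompact_Icc.prod isCompact_Icc).exists_bound_of_continuousOn hy
  have hyc : ContinuousOn (fun v => y v r) (Icc 0 T) :=
    hy.comp (f := fun v => (v, r)) (by fun_prop) fun v hv => ⟨hv, hrI⟩
  have key : ∀ t ∈ Icc 0 T, z t r = z 0 r + ∫ v in (0)..t, y v r := by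
    intro t ht
    have hsub : Icc 0 t ⊆ Icc 0 T := Icc_subset_Icc_right ht.2
    have hsub' : Set.uIoc 0 t ⊆ Icc 0 T := by
      rw [uIoc_of_le ht.1]; exact Ioc_subset_Icc_self.trans hsub
    have hint : ∀ s ∈ Icc l m, ∫ v in (0)..t, g v s = B t s - B 0 s := by
      intro s hs
      apply intervalIntegral.integral_eq_sub_of_hasDerivAt
      · intro v hv
        rw [uIcc_of_le ht.1] at hv
        exact hB v (hsub hv) s hs
      · apply ContinuousOn.intervalIntegrable
        rw [uIcc_of_le ht.1]
        exact (hgc s hs).mono hsub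
    have h1 : HasDerivAt (fun s => ∫ v in (0)..t, g v s) (∫ v in (0)..t, y v r) r := by
      refine (intervalIntegral.hasDerivAt_integral_of_dominated_loc_of_deriv_le
        (F := fun s v => g v s) (F' := fun s v => y v s) (bound := fun _ => K)
        hnhds ?_ ?_ ?_ ?_ ?_ ?_).2
      · filter_upwards [hnhds] with s hs
        exact ((hgc s hs).mono hsub').aestronglyMeasurable measurableSet_uIoc
      · apply ContinuousOn.intervalIntegrable
        rw [uIcc_of_le ht.1]
        exact (hgc r hrI).mono hsub
      · exact (hyc.mono hsub').aestronglyMeasurable measurableSet_uIoc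
      · exact Eventually.of_forall fun v hv s hs => hK (v, s) ⟨hsub' hv, hs⟩
      · exact intervalIntegrable_const
      · exact Eventually.of_forall fun v hv s hs => hg v (hsub' hv) s hs
    have h2 : HasDerivAt (fun s => B t s - B 0 s) (z t r - z 0 r) r :=
      (hz t ht).sub (hz 0 ⟨le_rfl, hT⟩)
    have h3 := h1.unique (h2.congr_of_eventuallyEq
      (by filter_upwards [hnhds] with s hs using hint s hs))
    linarith
  set Y : ℝ → ℝ := IccExtend hT ((Icc 0 T).domRestrict fun v => y v r) with hY
  have hYc : Continuous Y := (continuousOn_iff_continuous_domRestrict.1 hyc).Icc_extend'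
  have hYe : ∀ v ∈ Icc 0 T, Y v = y v r := fun v hv => by
    rw [hY, IccExtend_of_mem _ _ hv]; rfl
  have hF : HasDerivAt (fun t => z 0 r + ∫ v in (0)..t, Y v) (Y t) t :=
    (intervalIntegral.integral_hasDerivAt_right (hYc.intervalIntegrable _ _)
      (hYc.stronglyMeasurableAtFilter _ _) hYc.continuousAt).const_add _
  rw [← hYe t ht]
  have heq : ∀ s ∈ Icc 0 T, z s r = z 0 r + ∫ v in (0)..s, Y v := by
    intro s hs
    rw [key s hs]
    congr 1
    apply intervalIntegral.integral_congr
    intro v hv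
    rw [uIcc_of_le hs.1] at hv
    exact (hYe v ⟨hv.1, hv.2.trans hs.2⟩).symm
  exact hF.hasDerivWithinAt.congr heq (heq t ht)

/-- Radius at time `u - τ` of the ingoing null ray passing through radius `r` at time `u`,
where `a² = Λ / 3`. -/
noncomputable def rayRadius (a τ r : ℝ) : ℝ :=
  (a * r * (exp (a * τ) + 1) + (exp (a * τ) - 1)) /
    (a * ((exp (a * τ) + 1) + a * r * (exp (a * τ) - 1)))

/-- The derivative of `rayRadius a τ r` in `r`. -/
noncomputable def rayJacobian (a τ r : ℝ) : ℝ :=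
  4 * exp (a * τ) / ((exp (a * τ) + 1) + a * r * (exp (a * τ) - 1)) ^ 2

section rays

variable {a τ r : ℝ}

theorem one_le_exp_mul (ha : 0 < a) (hτ : 0 ≤ τ) : 1 ≤ exp (a * τ) :=
  one_le_exp (by positivity)

theorem exp_add_one_le_rayDenom (ha : 0 < a) (hτ : 0 ≤ τ) (hr : 0 ≤ r) :
    exp (a * τ) + 1 ≤ (exp (a * τ) + 1) + a * r * (exp (a * τ) - 1) := by
  have := one_le_exp_mul ha hτ
  have : 0 ≤ a * r * (exp (a * τ) - 1) := mul_nonneg (by positivity) (by linarith)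
  linarith

theorem rayDenom_pos (ha : 0 < a) (hτ : 0 ≤ τ) (hr : 0 ≤ r) :
    0 < (exp (a * τ) + 1) + a * r * (exp (a * τ) - 1) := by
  have := one_le_exp_mul ha hτ
  linarith [exp_add_one_le_rayDenom ha hτ hr]

theorem rayRadius_pos (ha : 0 < a) (hτ : 0 ≤ τ) (hr : 0 < r) : 0 < rayRadius a τ r := by
  have h1 := one_le_exp_mul ha hτ
  have h2 := rayDenom_pos ha hτ hr.le
  have h3 : 0 < a * r * (exp (a * τ) + 1) := by positivity
  unfold rayRadius
  apply div_pos <;> [linarith; positivity]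

theorem rayRadius_zero (ha : 0 < a) : rayRadius a 0 r = r := by
  unfold rayRadius
  simp
  field_simp

theorem rayJacobian_zero : rayJacobian a 0 r = 1 := by
  unfold rayJacobian
  simp
  norm_num

theorem hasDerivAt_rayRadius (ha : 0 < a) (hτ : 0 ≤ τ) (hr : 0 ≤ r) :
    HasDerivAt (fun r => rayRadius a τ r) (rayJacobian a τ r) r := by
  have hD := (rayDenom_pos ha hτ hr).ne'
  unfold rayRadius rayJacobian
  generalize exp (a * τ) = E at *
  have hn : HasDerivAt (fun r => a * r * (E + 1) + (E - 1)) (a * 1 * (E + 1)) r :=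
    (((hasDerivAt_id r).const_mul a).mul_const _).add_const _
  have hd : HasDerivAt (fun r => a * ((E + 1) + a * r * (E - 1))) (a * (a * 1 * (E - 1))) r :=
    ((((hasDerivAt_id r).const_mul a).mul_const _).const_add _).const_mul a
  refine (hn.div hd (mul_ne_zero ha.ne' hD)).congr_deriv ?_
  field_simp
  ring

theorem hasDerivAt_rayRadius_time (ha : 0 < a) (hτ : 0 ≤ τ) (hr : 0 ≤ r) :
    HasDerivAt (fun τ => rayRadius a τ r) ((1 - a ^ 2 * rayRadius a τ r ^ 2) / 2) τ := by
  have hD := (rayDenom_pos ha hτ hr).ne'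
  have hE : HasDerivAt (fun τ => exp (a * τ)) (exp (a * τ) * (a * 1)) τ :=
    ((hasDerivAt_id τ).const_mul a).exp
  unfold rayRadius
  have hn : HasDerivAt (fun τ => a * r * (exp (a * τ) + 1) + (exp (a * τ) - 1)) _ τ :=
    ((hE.add_const 1).const_mul (a * r)).add (hE.sub_const 1)
  have hd : HasDerivAt
      (fun τ => a * ((exp (a * τ) + 1) + a * r * (exp (a * τ) - 1))) _ τ :=
    ((hE.add_const 1).add ((hE.sub_const 1).const_mul (a * r))).const_mul a
  refine (hn.div hd (mul_ne_zero ha.ne' hD)).congr_deriv ?_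
  --   simp only [Pi.add_apply]
  generalize exp (a * τ) = E at *
  field_simp
  ring

theorem hasDerivAt_rayJacobian_time (ha : 0 < a) (hτ : 0 ≤ τ) (hr : 0 ≤ r) :
    HasDerivAt (fun τ => rayJacobian a τ r) (-(a ^ 2 * rayRadius a τ r) * rayJacobian a τ r) τ := by
  have hD := (rayDenom_pos ha hτ hr).ne'
  have hE : HasDerivAt (fun τ => exp (a * τ)) (exp (a * τ) * (a * 1)) τ :=
    ((hasDerivAt_id τ).const_mul a).exp
  unfold rayRadius rayJacobian
  have hn := hE.const_mul 4
  have hd : HasDerivAt (fun τ => ((exp (a * τ) + 1) + a * r * (exp (a * τ) - 1)) ^ 2)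
      (2 * ((exp (a * τ) + 1) + a * r * (exp (a * τ) - 1)) *
        (exp (a * τ) * (a * 1) + a * r * (exp (a * τ) * (a * 1)))) τ :=
    (((hE.add_const 1).add ((hE.sub_const 1).const_mul (a * r))).pow 2).congr_deriv (by simp)
  refine (hn.div hd (pow_ne_zero 2 hD)).congr_deriv ?_
  --   simp only [Pi.add_apply, Pi.pow_apply]
  generalize exp (a * τ) = E at *
  field_simp
  ring

theorem continuousOn_rayRadius (ha : 0 < a) :
    ContinuousOn (fun q : ℝ × ℝ => rayRadius a q.1 q.2) (Ici 0 ×ˢ Ici 0) := by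
  unfold rayRadius
  apply ContinuousOn.div (by fun_prop) (by fun_prop)
  rintro ⟨τ, r⟩ ⟨hτ, hr⟩
  exact (mul_pos ha (rayDenom_pos ha hτ hr)).ne'

theorem continuousOn_rayJacobian (ha : 0 < a) :
    ContinuousOn (fun q : ℝ × ℝ => rayJacobian a q.1 q.2) (Ici 0 ×ˢ Ici 0) := by
  unfold rayJacobian
  apply ContinuousOn.div (by fun_prop) (by fun_prop)
  rintro ⟨τ, r⟩ ⟨hτ, hr⟩
  exact (pow_pos (rayDenom_pos ha hτ hr) 2).ne'

/-- The Jacobian gains `e^{-aτ}`, with additional decay in `r` that compensates for the weight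
`(1 + r) ^ p` being evaluated along the ray. -/
theorem rpow_mul_rayJacobian_sq_le (ha : 0 < a) (hτ : 0 ≤ τ) (hr : 0 < r) {p : ℝ}
    (hp0 : 0 ≤ p) (hp4 : p ≤ 4) :
    (1 + rayRadius a τ r) ^ (-p) * rayJacobian a τ r ^ 2 ≤
      16 * exp (-(2 * a) * τ) * (1 + r) ^ (-p) := by
  have h1 := one_le_exp_mul ha hτ
  have hD := rayDenom_pos ha hτ hr.le
  have hDE := exp_add_one_le_rayDenom ha hτ hr.le
  have hρ := rayRadius_pos ha hτ hr
  have hexp : exp (-(2 * a) * τ) = (exp (a * τ) ^ 2)⁻¹ := by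
    rw [← exp_nat_mul, ← exp_neg]; congr 1; push_cast; ring
  rw [hexp]
  unfold rayJacobian
  have hρD : (1 + r) * (exp (a * τ) + 1) ≤
      (1 + rayRadius a τ r) * ((exp (a * τ) + 1) + a * r * (exp (a * τ) - 1)) := by
    have : rayRadius a τ r * ((exp (a * τ) + 1) + a * r * (exp (a * τ) - 1)) =
        r * (exp (a * τ) + 1) + (exp (a * τ) - 1) / a := by
      unfold rayRadius
      generalize exp (a * τ) = E at *
      field_simp
    have h2 : 0 ≤ (exp (a * τ) - 1) / a := div_nonneg (by linarith) ha.le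
    nlinarith
  generalize rayRadius a τ r = ρ at *
  set D := (exp (a * τ) + 1) + a * r * (exp (a * τ) - 1)
  generalize exp (a * τ) = E at *
  have hq : 1 ≤ D / (E + 1) := (one_le_div (by linarith)).2 hDE
  have h3 : (1 + r) / (D / (E + 1)) ≤ 1 + ρ := by
    rw [div_div_eq_mul_div, div_le_iff₀ hD]; exact hρD
  have h4 : (1 + ρ) ^ (-p) ≤ (1 + r) ^ (-p) * (D / (E + 1)) ^ (4 : ℕ) := by
    calc (1 + ρ) ^ (-p) ≤ ((1 + r) / (D / (E + 1))) ^ (-p) :=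
          rpow_le_rpow_of_nonpos (by positivity) h3 (by linarith)
      _ = (1 + r) ^ (-p) * (D / (E + 1)) ^ p := by
          rw [div_rpow (by positivity) (by positivity), rpow_neg (by positivity : 0 ≤ D / (E + 1)),
            div_inv_eq_mul]
      _ ≤ (1 + r) ^ (-p) * (D / (E + 1)) ^ (4 : ℝ) := by gcongr
      _ = _ := by norm_cast
  calc (1 + ρ) ^ (-p) * (4 * E / D ^ 2) ^ 2
      ≤ ((1 + r) ^ (-p) * (D / (E + 1)) ^ (4 : ℕ)) * (4 * E / D ^ 2) ^ 2 := by gcongr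
    _ = (1 + r) ^ (-p) * (16 * (E ^ 2 / (E + 1) ^ 4)) := by field_simp; ring
    _ ≤ (1 + r) ^ (-p) * (16 * (E ^ 2)⁻¹) := by
        gcongr
        rw [div_le_iff₀ (by positivity), inv_mul_eq_div, le_div_iff₀ (by positivity), ← pow_add]
        gcongr
        linarith
    _ = _ := by ring

end rays

section quadrant

variable {φ : ℝ → ℝ → ℝ} {u r : ℝ}

theorem uniqueDiffOn_quadrant : UniqueDiffOn ℝ (Ici (0 : ℝ) ×ˢ Ici (0 : ℝ)) :=
  (uniqueDiffOn_Ici 0).prod (uniqueDiffOn_Ici 0)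

theorem hasDerivWithinAt_fderivWithin_right
    (hφ : DifferentiableOn ℝ (fun q : ℝ × ℝ => φ q.1 q.2) (Ici 0 ×ˢ Ici 0))
    (hu : 0 ≤ u) (hr : 0 ≤ r) :
    HasDerivWithinAt (fun s => φ u s)
      (fderivWithin ℝ (fun q : ℝ × ℝ => φ q.1 q.2) (Ici 0 ×ˢ Ici 0) (u, r) (0, 1)) (Ici 0) r :=
  (hφ (u, r) ⟨hu, hr⟩).hasFDerivWithinAt.comp_hasDerivWithinAt (f := fun s => (u, s)) r
    ((hasDerivWithinAt_const _ _ _).prodMk (hasDerivWithinAt_id _ _)) fun _ hs => ⟨hu, hs⟩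

theorem hasDerivWithinAt_fderivWithin_left
    (hφ : DifferentiableOn ℝ (fun q : ℝ × ℝ => φ q.1 q.2) (Ici 0 ×ˢ Ici 0))
    (hu : 0 ≤ u) (hr : 0 ≤ r) :
    HasDerivWithinAt (fun v => φ v r)
      (fderivWithin ℝ (fun q : ℝ × ℝ => φ q.1 q.2) (Ici 0 ×ˢ Ici 0) (u, r) (1, 0)) (Ici 0) u :=
  (hφ (u, r) ⟨hu, hr⟩).hasFDerivWithinAt.comp_hasDerivWithinAt (f := fun v => (v, r)) u
    ((hasDerivWithinAt_id _ _).prodMk (hasDerivWithinAt_const _ _ _)) fun _ hv => ⟨hv, hr⟩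

theorem pderivR_eq_fderivWithin
    (hφ : DifferentiableOn ℝ (fun q : ℝ × ℝ => φ q.1 q.2) (Ici 0 ×ˢ Ici 0))
    (hu : 0 ≤ u) (hr : 0 ≤ r) :
    pderivR φ u r =
      fderivWithin ℝ (fun q : ℝ × ℝ => φ q.1 q.2) (Ici 0 ×ˢ Ici 0) (u, r) (0, 1) :=
  (hasDerivWithinAt_fderivWithin_right hφ hu hr).derivWithin (uniqueDiffOn_Ici 0 r hr)

theorem pderivU_eq_fderivWithin
    (hφ : DifferentiableOn ℝ (fun q : ℝ × ℝ => φ q.1 q.2) (Ici 0 ×ˢ Ici 0))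
    (hu : 0 ≤ u) (hr : 0 ≤ r) :
    pderivU φ u r =
      fderivWithin ℝ (fun q : ℝ × ℝ => φ q.1 q.2) (Ici 0 ×ˢ Ici 0) (u, r) (1, 0) :=
  (hasDerivWithinAt_fderivWithin_left hφ hu hr).derivWithin (uniqueDiffOn_Ici 0 u hu)

theorem hasDerivWithinAt_pderivR
    (hφ : DifferentiableOn ℝ (fun q : ℝ × ℝ => φ q.1 q.2) (Ici 0 ×ˢ Ici 0))
    (hu : 0 ≤ u) (hr : 0 ≤ r) :
    HasDerivWithinAt (fun s => φ u s) (pderivR φ u r) (Ici 0) r :=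
  pderivR_eq_fderivWithin hφ hu hr ▸ hasDerivWithinAt_fderivWithin_right hφ hu hr

theorem hasDerivWithinAt_pderivU
    (hφ : DifferentiableOn ℝ (fun q : ℝ × ℝ => φ q.1 q.2) (Ici 0 ×ˢ Ici 0))
    (hu : 0 ≤ u) (hr : 0 ≤ r) :
    HasDerivWithinAt (fun v => φ v r) (pderivU φ u r) (Ici 0) u :=
  pderivU_eq_fderivWithin hφ hu hr ▸ hasDerivWithinAt_fderivWithin_left hφ hu hr

theorem contDiffOn_pderivR
    (hφ : ContDiffOn ℝ 2 (fun q : ℝ × ℝ => φ q.1 q.2) (Ici 0 ×ˢ Ici 0)) :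
    ContDiffOn ℝ 1 (fun q : ℝ × ℝ => pderivR φ q.1 q.2) (Ici 0 ×ˢ Ici 0) :=
  ((hφ.fderivWithin uniqueDiffOn_quadrant (m := 1) (by norm_num)).clm_apply
    contDiffOn_const).congr fun _ hq =>
      pderivR_eq_fderivWithin (hφ.differentiableOn (by norm_num)) hq.1 hq.2

theorem continuousOn_pderivR
    (hφ : ContDiffOn ℝ 1 (fun q : ℝ × ℝ => φ q.1 q.2) (Ici 0 ×ˢ Ici 0)) :
    ContinuousOn (fun q : ℝ × ℝ => pderivR φ q.1 q.2) (Ici 0 ×ˢ Ici 0) :=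
  ((hφ.continuousOn_fderivWithin uniqueDiffOn_quadrant (by norm_num)).clm_apply
    continuousOn_const).congr fun _ hq =>
      pderivR_eq_fderivWithin (hφ.differentiableOn (by norm_num)) hq.1 hq.2

theorem quadrant_mem_nhds (hu : 0 < u) (hr : 0 < r) :
    Ici (0 : ℝ) ×ˢ Ici (0 : ℝ) ∈ 𝓝 (u, r) :=
  prod_mem_nhds (Ici_mem_nhds hu) (Ici_mem_nhds hr)

/-- Chain rule along a curve in the open quadrant. -/
theorem hasDerivAt_along_curve
    (hφ : DifferentiableOn ℝ (fun q : ℝ × ℝ => φ q.1 q.2) (Ici 0 ×ˢ Ici 0))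
    {α β : ℝ → ℝ} {α' β' t : ℝ} (hα : HasDerivAt α α' t) (hβ : HasDerivAt β β' t)
    (hα0 : 0 < α t) (hβ0 : 0 < β t) :
    HasDerivAt (fun t => φ (α t) (β t))
      (α' * pderivU φ (α t) (β t) + β' * pderivR φ (α t) (β t)) t := by
  rw [pderivU_eq_fderivWithin hφ hα0.le hβ0.le, pderivR_eq_fderivWithin hφ hα0.le hβ0.le]
  have h := ((hφ (α t, β t) ⟨hα0.le, hβ0.le⟩).hasFDerivWithinAt.hasFDerivAt
    (quadrant_mem_nhds hα0 hβ0)).comp_hasDerivAt t (hα.prodMk hβ)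
  refine h.congr_deriv ?_
  have : ((α', β') : ℝ × ℝ) = α' • ((1, 0) : ℝ × ℝ) + β' • ((0, 1) : ℝ × ℝ) := by simp
  rw [this, map_add, map_smul, map_smul, smul_eq_mul, smul_eq_mul]

theorem pderivU_pderivR_comm
    (hφ : ContDiffOn ℝ 2 (fun q : ℝ × ℝ => φ q.1 q.2) (Ici 0 ×ˢ Ici 0))
    (hu : 0 < u) (hr : 0 < r) :
    pderivU (pderivR φ) u r = pderivR (pderivU φ) u r := by
  set Φ : ℝ × ℝ → ℝ := fun q => φ q.1 q.2
  have hd := hφ.differentiableOn (by norm_num)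
  have hAt : ContDiffAt ℝ 2 Φ (u, r) := hφ.contDiffAt (quadrant_mem_nhds hu hr)
  have hD : HasFDerivAt (fderiv ℝ Φ) (fderiv ℝ (fderiv ℝ Φ) (u, r)) (u, r) :=
    ((hAt.fderiv_right (m := 1) (by norm_num)).differentiableAt (by norm_num)).hasFDerivAt
  have hR : HasDerivAt (fun v => pderivR φ v r) (fderiv ℝ (fderiv ℝ Φ) (u, r) (1, 0) (0, 1)) u := by
    have h := (hD.comp_hasDerivAt (f := fun v => (v, r)) u
      ((hasDerivAt_id u).prodMk (hasDerivAt_const u r))).clm_apply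
        (hasDerivAt_const u ((0, 1) : ℝ × ℝ))
    simp only [map_zero, add_zero] at h
    refine h.congr_of_eventuallyEq ?_
    filter_upwards [Ioi_mem_nhds hu] with v hv
    rw [pderivR_eq_fderivWithin hd (le_of_lt hv) hr.le,
      fderivWithin_of_mem_nhds (quadrant_mem_nhds hv hr)]
    rfl
  have hU : HasDerivAt (fun s => pderivU φ u s) (fderiv ℝ (fderiv ℝ Φ) (u, r) (0, 1) (1, 0)) r := by
    have h := (hD.comp_hasDerivAt (f := fun s => (u, s)) r
      ((hasDerivAt_const r u).prodMk (hasDerivAt_id r))).clm_apply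
        (hasDerivAt_const r ((1, 0) : ℝ × ℝ))
    simp only [map_zero, add_zero] at h
    refine h.congr_of_eventuallyEq ?_
    filter_upwards [Ioi_mem_nhds hr] with s hs
    rw [pderivU_eq_fderivWithin hd hu.le (le_of_lt hs),
      fderivWithin_of_mem_nhds (quadrant_mem_nhds hu hs)]
    rfl
  have h1 : pderivU (pderivR φ) u r = _ :=
    hR.hasDerivWithinAt.derivWithin (uniqueDiffOn_Ici 0 u hu.le)
  have h2 : pderivR (pderivU φ) u r = _ :=
    hU.hasDerivWithinAt.derivWithin (uniqueDiffOn_Ici 0 r hr.le)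
  rw [h1, h2]
  exact hAt.isSymmSndFDerivAt (by simp) _ _

end quadrant

/-- The second radial derivative `∂ᵣ²(rφ)`, expanded. -/
noncomputable def radialSnd (φ : ℝ → ℝ → ℝ) (u r : ℝ) : ℝ :=
  2 * pderivR φ u r + r * pderivR (pderivR φ) u r

theorem continuousOn_radialSnd {φ : ℝ → ℝ → ℝ}
    (hφ : ContDiffOn ℝ 2 (fun q : ℝ × ℝ => φ q.1 q.2) (Ici 0 ×ˢ Ici 0)) :
    ContinuousOn (fun q : ℝ × ℝ => radialSnd φ q.1 q.2) (Ici 0 ×ˢ Ici 0) := by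
  have h1 := (contDiffOn_pderivR hφ).continuousOn
  have h2 := continuousOn_pderivR (contDiffOn_pderivR hφ)
  unfold radialSnd
  fun_prop

theorem derivWithin_derivWithin_mul_eq_radialSnd {φ : ℝ → ℝ → ℝ}
    (hφ : ContDiffOn ℝ 2 (fun q : ℝ × ℝ => φ q.1 q.2) (Ici 0 ×ˢ Ici 0))
    {u r : ℝ} (hu : 0 ≤ u) (hr : 0 ≤ r) :
    derivWithin (fun s => derivWithin (fun s' => s' * φ u s') (Ici 0) s) (Ici 0) r =
      radialSnd φ u r := by
  have h1 : ∀ s ∈ Ici (0 : ℝ), derivWithin (fun s' => s' * φ u s') (Ici 0) s =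
      φ u s + s * pderivR φ u s := fun s hs => by
    have := (hasDerivWithinAt_id s (Ici 0)).mul
      (hasDerivWithinAt_pderivR (hφ.differentiableOn (by norm_num)) hu hs)
    exact (this.derivWithin (uniqueDiffOn_Ici 0 s hs)).trans (by simp)
  rw [derivWithin_congr h1 (h1 r hr)]
  have h2 := (hasDerivWithinAt_pderivR (hφ.differentiableOn (by norm_num)) hu hr).add
    ((hasDerivWithinAt_id r (Ici 0)).mul (hasDerivWithinAt_pderivR
      ((contDiffOn_pderivR hφ).differentiableOn (by norm_num)) hu hr))
  refine (h2.derivWithin (uniqueDiffOn_Ici 0 r hr)).trans ?_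
  simp only [radialSnd, id]
  ring

section transport

variable {Λ a : ℝ} {φ : ℝ → ℝ → ℝ}

/-- For a solution, `∂ᵣ²(rφ)` scales by the square of the ray Jacobian along ingoing null rays. -/
theorem rayJacobian_sq_mul_radialSnd_of_lt
    (hφ : ContDiffOn ℝ 2 (fun q : ℝ × ℝ => φ q.1 q.2) (Ici 0 ×ˢ Ici 0))
    (hwave : IsWaveSol Λ φ) (ha : 0 < a) (haΛ : a ^ 2 = Λ / 3)
    {U R T : ℝ} (hR : 0 < R) (hT0 : 0 ≤ T) (hTU : T < U) :
    rayJacobian a T R ^ 2 * radialSnd φ (U - T) (rayRadius a T R) = radialSnd φ U R := by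
  have hd := hφ.differentiableOn (by norm_num)
  have hd' := (contDiffOn_pderivR hφ).differentiableOn (by norm_num)
  have hRI : R ∈ Ioo (R / 2) (2 * R) := ⟨by linarith, by linarith⟩
  have hsub : Icc 0 T ×ˢ Icc (R / 2) (2 * R) ⊆ Ici 0 ×ˢ Ici 0 := fun q hq =>
    ⟨hq.1.1, (by linarith [hq.2.1] : (0 : ℝ) ≤ q.2)⟩
  have hmaps : MapsTo (fun q : ℝ × ℝ => (U - q.1, rayRadius a q.1 q.2))
      (Icc 0 T ×ˢ Icc (R / 2) (2 * R)) (Ici 0 ×ˢ Ici 0) := fun q hq =>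
    ⟨(by linarith [hq.1.2] : (0 : ℝ) ≤ U - q.1),
      (rayRadius_pos ha hq.1.1 (by linarith [hq.2.1])).le⟩
  have hcρ := (continuousOn_rayRadius ha).mono hsub
  have hcJ := (continuousOn_rayJacobian ha).mono hsub
  have hcurve : ContinuousOn (fun q : ℝ × ℝ => (U - q.1, rayRadius a q.1 q.2))
      (Icc 0 T ×ˢ Icc (R / 2) (2 * R)) := by fun_prop
  have hcw := (continuousOn_radialSnd hφ).comp hcurve hmaps
  have hcr := (contDiffOn_pderivR hφ).continuousOn.comp hcurve hmaps
  have htime : ∀ v, HasDerivAt (fun v => U - v) (-1) v := fun v => by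
    simpa using (hasDerivAt_id v).const_sub U
  have hz : ∀ t ∈ Icc 0 T, HasDerivWithinAt
      (fun v => rayJacobian a v R * radialSnd φ (U - v) (rayRadius a v R))
      (a ^ 2 * rayRadius a t R *
        (rayJacobian a t R * radialSnd φ (U - t) (rayRadius a t R))) (Icc 0 T) t := by
    intro t ht
    refine hasDerivWithinAt_of_mixed_partial hRI
      (B := fun v s => φ (U - v) (rayRadius a v s) +
        rayRadius a v s * pderivR φ (U - v) (rayRadius a v s))
      (g := fun v s => a ^ 2 * rayRadius a v s ^ 2 * pderivR φ (U - v) (rayRadius a v s))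
      (z := fun v s => rayJacobian a v s * radialSnd φ (U - v) (rayRadius a v s))
      (y := fun v s => a ^ 2 * rayRadius a v s *
        (rayJacobian a v s * radialSnd φ (U - v) (rayRadius a v s))) ?_ ?_ ?_ ?_ ?_ ht
    · intro v hv s hs
      have hs0 : 0 < s := by linarith [hs.1]
      have hv0 : 0 < U - v := by linarith [hv.2]
      have hρ0 := rayRadius_pos ha hv.1 hs0
      have hρ := hasDerivAt_rayRadius_time ha hv.1 hs0.le
      have h := (hasDerivAt_along_curve hd (htime v) hρ hv0 hρ0).add
        (hρ.mul (hasDerivAt_along_curve hd' (htime v) hρ hv0 hρ0))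
      refine h.congr_deriv ?_
      have hw := hwave _ _ hv0.le hρ0.le
      rw [pderivU_pderivR_comm hφ hv0 hρ0, haΛ]
      linear_combination (1 / 2) * hw
    · intro v hv
      have hv0 : 0 < U - v := by linarith [hv.2]
      have hρ0 := rayRadius_pos ha hv.1 hR
      have hρ := hasDerivAt_rayRadius ha hv.1 hR.le
      have h := (hasDerivAt_along_curve hd (hasDerivAt_const R (U - v)) hρ hv0 hρ0).add
        (hρ.mul (hasDerivAt_along_curve hd' (hasDerivAt_const R (U - v)) hρ hv0 hρ0))
      refine h.congr_deriv ?_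
      unfold radialSnd
      ring
    · intro v hv s hs
      have hs0 : 0 < s := by linarith [hs.1]
      have hv0 : 0 < U - v := by linarith [hv.2]
      have hρ0 := rayRadius_pos ha hv.1 hs0
      have hρ := hasDerivAt_rayRadius ha hv.1 hs0.le
      have h := ((hρ.pow 2).const_mul (a ^ 2)).mul
        (hasDerivAt_along_curve hd' (hasDerivAt_const s (U - v)) hρ hv0 hρ0)
      refine h.congr_deriv ?_
      simp only [radialSnd, Pi.pow_apply]
      push_cast
      ring
    · intro s hs
      have hc : ContinuousOn (fun q : ℝ × ℝ => a ^ 2 * rayRadius a q.1 q.2 ^ 2 *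
          pderivR φ (U - q.1) (rayRadius a q.1 q.2)) (Icc 0 T ×ˢ Icc (R / 2) (2 * R)) :=
        (continuousOn_const.mul (hcρ.pow 2)).mul hcr
      exact hc.comp (f := fun v => (v, s)) (by fun_prop) fun v hv => ⟨hv, hs⟩
    · exact (continuousOn_const.mul hcρ).mul (hcJ.mul hcw)
  have hE : ∀ t ∈ Icc 0 T, HasDerivWithinAt (fun v => rayJacobian a v R *
      (rayJacobian a v R * radialSnd φ (U - v) (rayRadius a v R))) 0 (Icc 0 T) t := by
    intro t ht
    refine ((hasDerivAt_rayJacobian_time ha ht.1 hR.le).hasDerivWithinAt.mul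
      (hz t ht)).congr_deriv ?_
    ring
  have hconst := constant_of_has_deriv_right_zero (fun t ht => (hE t ht).continuousWithinAt)
    (fun t ht => (hE t (Ico_subset_Icc_self ht)).mono_of_mem_nhdsWithin
      (Icc_mem_nhdsGE_of_mem ht)) T ⟨hT0, le_rfl⟩
  simp only [rayJacobian_zero, rayRadius_zero ha, sub_zero, one_mul] at hconst
  rw [← hconst]
  ring

theorem radialSnd_eq_rayJacobian_sq_mul
    (hφ : ContDiffOn ℝ 2 (fun q : ℝ × ℝ => φ q.1 q.2) (Ici 0 ×ˢ Ici 0))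
    (hwave : IsWaveSol Λ φ) (ha : 0 < a) (haΛ : a ^ 2 = Λ / 3)
    {u r : ℝ} (hu : 0 ≤ u) (hr : 0 < r) :
    radialSnd φ u r = rayJacobian a u r ^ 2 * radialSnd φ 0 (rayRadius a u r) := by
  rcases hu.eq_or_lt with rfl | hu
  · simp [rayJacobian_zero, rayRadius_zero ha]
  have hmaps : MapsTo (fun v : ℝ => (v, r)) (Icc 0 u) (Ici 0 ×ˢ Ici 0) :=
    fun v hv => ⟨hv.1, hr.le⟩
  have hcρ := (continuousOn_rayRadius ha).comp (f := fun v : ℝ => (v, r)) (by fun_prop) hmaps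
  have hcJ := (continuousOn_rayJacobian ha).comp (f := fun v : ℝ => (v, r)) (by fun_prop) hmaps
  simp only [Function.comp_def] at hcρ hcJ
  have hcw := (continuousOn_radialSnd hφ).comp (s := Icc 0 u)
    (f := fun v : ℝ => (u - v, rayRadius a v r)) (by fun_prop)
    fun v hv => ⟨sub_nonneg.2 hv.2, (rayRadius_pos ha hv.1 hr).le⟩
  have hEq : EqOn (fun v => rayJacobian a v r ^ 2 * radialSnd φ (u - v) (rayRadius a v r))
      (fun _ => radialSnd φ u r) (Ico 0 u) := fun v hv =>
    rayJacobian_sq_mul_radialSnd_of_lt hφ hwave ha haΛ hr hv.1 hv.2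
  have := hEq.of_subset_closure ((hcJ.pow 2).mul hcw) continuousOn_const Ico_subset_Icc_self
    (closure_Ico hu.ne).ge (right_mem_Icc.2 hu.le)
  simpa using this.symm

end transport

theorem abs_sub_le_of_abs_deriv_le {f f' B B' : ℝ → ℝ}
    (hf : ∀ s, 0 ≤ s → HasDerivWithinAt f (f' s) (Ici 0) s)
    (hB : ∀ s, 0 ≤ s → HasDerivAt B (B' s) s) (h : ∀ s, 0 ≤ s → |f' s| ≤ B' s)
    {x y : ℝ} (hx : 0 ≤ x) (hxy : x ≤ y) : |f y - f x| ≤ B y - B x := by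
  refine image_norm_le_of_norm_deriv_right_le_deriv_boundary' (f := fun s => f s - f x)
    (B := fun s => B s - B x) (f' := f') (B' := B') (a := x) (b := y) ?_ ?_ (by simp) ?_ ?_
    (fun s hs => h s (hx.trans hs.1)) ⟨hxy, le_rfl⟩
  · intro s hs
    exact (((hf s (hx.trans hs.1)).continuousWithinAt).mono
      fun t ht => hx.trans ht.1).sub_const _
  · intro s hs
    exact ((hf s (hx.trans hs.1)).mono (Ici_subset_Ici.2 (hx.trans hs.1))).sub_const _
  · intro s hs
    exact ((hB s (hx.trans hs.1)).continuousAt.continuousWithinAt).sub_const _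
  · intro s hs
    exact ((hB s (hx.trans hs.1)).hasDerivWithinAt).sub_const _

/-- A Cauchy-type criterion giving a limit together with the rate of convergence. -/
theorem exists_abs_sub_le_of_abs_sub_le {f E : ℝ → ℝ} (hE : ∀ u, 0 ≤ u → 0 ≤ E u)
    (h : ∀ u v, 0 ≤ u → u ≤ v → |f v - f u| ≤ E u - E v) :
    ∃ L, ∀ u, 0 ≤ u → |f u - L| ≤ E u := by
  obtain ⟨L, hL1, hL2⟩ := exists_between_of_forall_le
    (s := (fun u => f u - E u) '' Ici 0) (t := (fun u => f u + E u) '' Ici 0)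
    (nonempty_Ici.image _) (nonempty_Ici.image _) (by
      rintro _ ⟨u, hu, rfl⟩ _ ⟨v, hv, rfl⟩
      have h1 := abs_le.1 (h u (max u v) hu (le_max_left _ _))
      have h2 := abs_le.1 (h v (max u v) hv (le_max_right _ _))
      have h3 := hE (max u v) (le_trans hu (le_max_left _ _))
      simp only
      linarith [h1.1, h2.2])
  refine ⟨L, fun u hu => abs_le.2 ⟨?_, ?_⟩⟩
  · linarith [hL2 ⟨u, hu, rfl⟩]
  · linarith [hL1 ⟨u, hu, rfl⟩]

section radial

variable {φ : ℝ → ℝ → ℝ} {u K p : ℝ}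

theorem hasDerivWithinAt_sq_mul_pderivR
    (hφ : ContDiffOn ℝ 2 (fun q : ℝ × ℝ => φ q.1 q.2) (Ici 0 ×ˢ Ici 0))
    (hu : 0 ≤ u) {r : ℝ} (hr : 0 ≤ r) :
    HasDerivWithinAt (fun s => s ^ 2 * pderivR φ u s) (r * radialSnd φ u r) (Ici 0) r := by
  refine (((hasDerivAt_pow 2 r).hasDerivWithinAt).mul (hasDerivWithinAt_pderivR
      ((contDiffOn_pderivR hφ).differentiableOn (by norm_num)) hu hr)).congr_deriv ?_
  unfold radialSnd
  push_cast
  ring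

theorem abs_pderivR_le
    (hφ : ContDiffOn ℝ 2 (fun q : ℝ × ℝ => φ q.1 q.2) (Ici 0 ×ˢ Ici 0)) (hu : 0 ≤ u)
    (hw : ∀ r, 0 < r → |radialSnd φ u r| ≤ K) {r : ℝ} (hr : 0 ≤ r) :
    |pderivR φ u r| ≤ K / 2 := by
  have hpos : ∀ r, 0 < r → |pderivR φ u r| ≤ K / 2 := by
    intro r hr
    have h := abs_sub_le_of_abs_deriv_le (B := fun s => K / 2 * s ^ 2) (B' := fun s => s * K)
      (fun s hs => hasDerivWithinAt_sq_mul_pderivR hφ hu hs)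
      (fun s _ => ((hasDerivAt_pow 2 s).const_mul (K / 2)).congr_deriv (by push_cast; ring))
      (fun s hs => by
        rcases hs.eq_or_lt with rfl | hs
        · simp
        · rw [abs_mul, abs_of_pos hs]
          exact mul_le_mul_of_nonneg_left (hw s hs) hs.le) le_rfl hr.le
    simp only [ne_eq, OfNat.ofNat_ne_zero, not_false_eq_true, zero_pow, zero_mul, mul_zero,
      sub_zero, abs_mul, abs_pow, abs_of_pos hr] at h
    rw [mul_comm] at h
    exact le_of_mul_le_mul_right h (by positivity)
  have hc : ContinuousOn (fun s => |pderivR φ u s|) (Ici 0) :=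
    ((contDiffOn_pderivR hφ).continuousOn.comp (f := fun s => (u, s)) (by fun_prop)
      fun s hs => ⟨hu, hs⟩).abs
  rw [← closure_Ioi] at hc
  exact le_on_closure (s := Ioi 0) hpos hc continuousOn_const (by rwa [closure_Ioi])

theorem abs_sub_axis_le_mul
    (hφ : ContDiffOn ℝ 2 (fun q : ℝ × ℝ => φ q.1 q.2) (Ici 0 ×ˢ Ici 0)) (hu : 0 ≤ u)
    (hw : ∀ r, 0 < r → |radialSnd φ u r| ≤ K) {r : ℝ} (hr : 0 ≤ r) :
    |φ u r - φ u 0| ≤ K / 2 * r := by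
  have h := abs_sub_le_of_abs_deriv_le (B := fun s => K / 2 * s) (B' := fun _ => K / 2)
    (fun s hs => hasDerivWithinAt_pderivR (hφ.differentiableOn (by norm_num)) hu hs)
    (fun s _ => by simpa using (hasDerivAt_id s).const_mul (K / 2))
    (fun s hs => abs_pderivR_le hφ hu hw hs) le_rfl hr
  simpa using h

theorem abs_pderivR_le_div_sq
    (hφ : ContDiffOn ℝ 2 (fun q : ℝ × ℝ => φ q.1 q.2) (Ici 0 ×ˢ Ici 0)) (hu : 0 ≤ u)
    (hK : 0 ≤ K) (hp : 2 < p)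
    (hw : ∀ r, 0 < r → |radialSnd φ u r| ≤ K * (1 + r) ^ (-p)) {r : ℝ} (hr : 0 < r) :
    |pderivR φ u r| ≤ K / (p - 2) / r ^ 2 := by
  have hp' : 0 < p - 2 := by linarith
  have h := abs_sub_le_of_abs_deriv_le
    (B := fun s => K / (p - 2) * (1 - (1 + s) ^ (2 - p))) (B' := fun s => K * (1 + s) ^ (1 - p))
    (fun s hs => hasDerivWithinAt_sq_mul_pderivR hφ hu hs)
    (fun s hs => by
      have h1 : HasDerivAt (fun s : ℝ => 1 + s) 1 s := (hasDerivAt_id s).const_add 1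
      refine (((h1.rpow_const (p := 2 - p) (Or.inl (by positivity))).const_sub 1).const_mul
        (K / (p - 2))).congr_deriv ?_
      rw [show 2 - p - 1 = 1 - p by ring]
      field_simp
      ring)
    (fun s hs => by
      rcases hs.eq_or_lt with rfl | hs
      · simpa using hK
      · rw [abs_mul, abs_of_pos hs, sub_eq_add_neg, rpow_add (by positivity), rpow_one]
        have := hw s hs
        have h2 : 0 ≤ (1 + s) ^ (-p) := by positivity
        calc s * |radialSnd φ u s| ≤ s * (K * (1 + s) ^ (-p)) := by gcongr
          _ ≤ (1 + s) * (K * (1 + s) ^ (-p)) := by gcongr; linarith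
          _ = _ := by ring) le_rfl hr.le
  simp only [ne_eq, OfNat.ofNat_ne_zero, not_false_eq_true, zero_pow, zero_mul, mul_zero,
    sub_zero, abs_mul, abs_pow, abs_of_pos hr, add_zero, one_rpow, sub_self] at h
  rw [le_div_iff₀ (by positivity), mul_comm]
  refine h.trans (mul_le_of_le_one_right (by positivity) ?_)
  have : 0 ≤ (1 + r) ^ (2 - p) := by positivity
  linarith

theorem abs_sub_axis_le
    (hφ : ContDiffOn ℝ 2 (fun q : ℝ × ℝ => φ q.1 q.2) (Ici 0 ×ˢ Ici 0)) (hu : 0 ≤ u)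
    (hK : 0 ≤ K) (hp : 2 < p)
    (hw : ∀ r, 0 < r → |radialSnd φ u r| ≤ K * (1 + r) ^ (-p)) {r : ℝ} (hr : 0 ≤ r) :
    |φ u r - φ u 0| ≤ (2 + 4 / (p - 2)) * K := by
  have hp' : 0 < p - 2 := by linarith
  have hw' : ∀ r, 0 < r → |radialSnd φ u r| ≤ K := fun r hr =>
    (hw r hr).trans (mul_le_of_le_one_right hK
      (rpow_le_one_of_one_le_of_nonpos (by linarith) (by linarith)))
  have h := abs_sub_le_of_abs_deriv_le
    (B := fun s => (2 + 4 / (p - 2)) * K * (1 - (1 + s)⁻¹))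
    (B' := fun s => (2 + 4 / (p - 2)) * K * ((1 + s) ^ 2)⁻¹)
    (fun s hs => hasDerivWithinAt_pderivR (hφ.differentiableOn (by norm_num)) hu hs)
    (fun s hs => by
      have h1 : HasDerivAt (fun s : ℝ => 1 + s) 1 s := (hasDerivAt_id s).const_add 1
      refine (((h1.fun_inv (by positivity)).const_sub 1).const_mul
        ((2 + 4 / (p - 2)) * K)).congr_deriv ?_
      rw [neg_div, neg_neg, one_div])
    (fun s hs => by
      rw [← div_eq_mul_inv, add_mul, add_div]
      rcases le_total s 1 with hs1 | hs1
      · refine (abs_pderivR_le hφ hu hw' hs).trans (le_add_of_le_of_nonneg ?_ (by positivity))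
        rw [div_le_div_iff₀ (by positivity) (by positivity)]
        nlinarith [mul_nonneg hK (by nlinarith : 0 ≤ 4 - (1 + s) ^ 2)]
      · refine (abs_pderivR_le_div_sq hφ hu hK hp hw (by linarith)).trans
          (le_add_of_nonneg_of_le (by positivity) ?_)
        rw [div_mul_eq_mul_div, mul_div_assoc, ← mul_div_assoc, div_div, div_div,
          div_le_div_iff₀ (by positivity) (by positivity)]
        have : (1 + s) ^ 2 ≤ 4 * s ^ 2 := by nlinarith
        calc K * ((p - 2) * (1 + s) ^ 2) ≤ K * ((p - 2) * (4 * s ^ 2)) := by gcongr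
          _ = _ := by ring) le_rfl hr
  simp only [add_zero, inv_one, sub_self, mul_zero, sub_zero] at h
  refine h.trans (mul_le_of_le_one_right (by positivity) ?_)
  have : 0 ≤ (1 + r)⁻¹ := by positivity
  linarith

end radial

/-- Price law / uniform exponential decay for spherical linear waves
in de Sitter: if `φ ∈ C²([0,∞)²)` solves the spherically symmetric wave equation with
`sup_{r≥0} |∂_r (r φ(0,r))| < ∞` and `sup_{r≥0} (1+r)^p |∂²_r (r φ(0,r))| < ∞` for
some `0 ≤ p ≤ 4`, and `0 < H ≤ 2√(Λ/3)`, then there exist `φ̲ ∈ ℝ` and `C > 0` with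
`|φ(u,r) - φ̲| ≤ C (1+r)^{n(p)} e^{-Hu}`. -/
theorem wave_dS_price_law
    (Λ : ℝ) (hΛ : 0 < Λ) (p : ℝ) (hp0 : 0 ≤ p) (hp4 : p ≤ 4)
    (H : ℝ) (hH0 : 0 < H) (hH : H ≤ 2 * Real.sqrt (Λ / 3))
    (φ : ℝ → ℝ → ℝ)
    (hreg : ContDiffOn ℝ 2 (fun q : ℝ × ℝ => φ q.1 q.2) (Set.Ici 0 ×ˢ Set.Ici 0))
    (hwave : IsWaveSol Λ φ)
    (hd1 : ∃ M : ℝ, ∀ r, 0 ≤ r →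
      |derivWithin (fun r' => r' * φ 0 r') (Set.Ici 0) r| ≤ M)
    (hd2 : ∃ M : ℝ, ∀ r, 0 ≤ r →
      (1 + r) ^ p *
        |derivWithin (fun r'' =>
          derivWithin (fun r' => r' * φ 0 r') (Set.Ici 0) r'') (Set.Ici 0) r| ≤ M) :
    ∃ (φlim C : ℝ), 0 < C ∧
      ∀ u r : ℝ, 0 ≤ u → 0 ≤ r →
        |φ u r - φlim| ≤ C * (1 + r) ^ (nExp p) * Real.exp (-H * u) := by
  set a : ℝ := √(Λ / 3)
  have ha : 0 < a := sqrt_pos.2 (by positivity)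
  have haΛ : a ^ 2 = Λ / 3 := sq_sqrt (by positivity)
  obtain ⟨M, hM⟩ := hd2
  have hM' : ∀ r, 0 ≤ r → |radialSnd φ 0 r| ≤ M * (1 + r) ^ (-p) := fun r hr => by
    have h := hM r hr
    rw [derivWithin_derivWithin_mul_eq_radialSnd hreg le_rfl hr] at h
    rw [rpow_neg (by positivity), ← div_eq_mul_inv, le_div_iff₀ (by positivity), mul_comm]
    exact h
  have hM0 : 0 ≤ M := by simpa using (abs_nonneg _).trans (hM' 0 le_rfl)
  set K : ℝ → ℝ := fun u => 16 * M * exp (-(2 * a) * u) with hK_def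
  have hK0 : ∀ u, 0 ≤ K u := fun u => by positivity
  have hw : ∀ u r, 0 ≤ u → 0 < r → |radialSnd φ u r| ≤ K u * (1 + r) ^ (-p) := by
    intro u r hu hr
    rw [radialSnd_eq_rayJacobian_sq_mul hreg hwave ha haΛ hu hr, abs_mul,
      abs_of_nonneg (sq_nonneg _)]
    calc rayJacobian a u r ^ 2 * |radialSnd φ 0 (rayRadius a u r)|
        ≤ rayJacobian a u r ^ 2 * (M * (1 + rayRadius a u r) ^ (-p)) := by
          gcongr
          exact hM' _ (rayRadius_pos ha hu hr).le
      _ = M * ((1 + rayRadius a u r) ^ (-p) * rayJacobian a u r ^ 2) := by ring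
      _ ≤ M * (16 * exp (-(2 * a) * u) * (1 + r) ^ (-p)) :=
          mul_le_mul_of_nonneg_left (rpow_mul_rayJacobian_sq_le ha hu hr hp0 hp4) hM0
      _ = _ := by ring
  have hw' : ∀ u r, 0 ≤ u → 0 < r → |radialSnd φ u r| ≤ K u := fun u r hu hr =>
    (hw u r hu hr).trans (mul_le_of_le_one_right (hK0 u)
      (rpow_le_one_of_one_le_of_nonpos (by linarith) (by linarith)))
  obtain ⟨L, hL⟩ : ∃ L, ∀ u, 0 ≤ u → |φ u 0 - L| ≤ K u / (4 * a) := by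
    refine exists_abs_sub_le_of_abs_sub_le (f := fun u => φ u 0)
      (fun u _ => div_nonneg (hK0 u) (by positivity)) fun u v hu huv => ?_
    have h := abs_sub_le_of_abs_deriv_le (B := fun u => -(K u / (4 * a))) (B' := fun u => K u / 2)
      (fun s hs => hasDerivWithinAt_pderivU (hreg.differentiableOn (by norm_num)) hs le_rfl)
      (fun s _ => by
        refine ((((hasDerivAt_id s).const_mul (-(2 * a))).exp.const_mul (16 * M)).div_const
          (4 * a)).neg.congr_deriv ?_
        simp only [hK_def, id]
        field_simp
        ring)
      (fun s hs => by
        have h0 := hwave s 0 hs le_rfl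
        have h1 : pderivU φ s 0 = pderivR φ s 0 := by linarith
        rw [h1]
        exact abs_pderivR_le hreg hs (fun r hr => hw' s r hs hr) le_rfl) hu huv
    exact h.trans_eq (by ring)
  obtain ⟨A, hA0, hA⟩ : ∃ A, 0 ≤ A ∧ ∀ u r, 0 ≤ u → 0 ≤ r →
      |φ u r - φ u 0| ≤ A * K u * (1 + r) ^ nExp p := by
    by_cases hp : 2 < p
    · have hp' : 0 < p - 2 := by linarith
      refine ⟨2 + 4 / (p - 2), by positivity, fun u r hu hr => ?_⟩
      simpa [nExp, hp] using abs_sub_axis_le hreg hu (hK0 u) hp (fun r hr => hw u r hu hr) hr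
    · refine ⟨1 / 2, by positivity, fun u r hu hr => ?_⟩
      refine (abs_sub_axis_le_mul hreg hu (fun r hr => hw' u r hu hr) hr).trans ?_
      rw [nExp, if_neg hp, rpow_two, one_div_mul_eq_div]
      have := hK0 u
      gcongr
      nlinarith
  have hn : 0 ≤ nExp p := by unfold nExp; split_ifs <;> norm_num
  refine ⟨L, 16 * M * (A + 1 / (4 * a)) + 1, by positivity, fun u r hu hr => ?_⟩
  have h1 : 1 ≤ (1 + r) ^ nExp p := one_le_rpow (by linarith) hn
  have hexp : exp (-(2 * a) * u) ≤ exp (-H * u) := exp_le_exp.2 (by nlinarith)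
  calc |φ u r - L| ≤ |φ u r - φ u 0| + |φ u 0 - L| := abs_sub_le _ _ _
    _ ≤ A * K u * (1 + r) ^ nExp p + K u / (4 * a) * (1 + r) ^ nExp p :=
        add_le_add (hA u r hu hr) ((hL u hu).trans
          (le_mul_of_one_le_right (div_nonneg (hK0 u) (by positivity)) h1))
    _ = 16 * M * (A + 1 / (4 * a)) * (1 + r) ^ nExp p * exp (-(2 * a) * u) := by
        simp only [hK_def]; ring
    _ ≤ (16 * M * (A + 1 / (4 * a)) + 1) * (1 + r) ^ nExp p * exp (-H * u) := by
        gcongr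
        linarith
end
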